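/- (Theorem 2, observer-based output feedback.) Under the multi-agent setup below, with additionally H_i ∈ ℝ^{n_i×q} such that A_i − H_iC_i is Hurwitz, there exist positive constants γ₁ and γ₂ such that the following holds. Let x_i, x̂_i : [0,∞) → ℝ^{n_i}, ρ_i, v_i : [0,∞) → ℝ^q and z_i : [0,∞) → ℝ^N be differentiable functions with v_i(0) = 0 and z_i(0) = e_i (the i-th standard basis vector of ℝ^N), satisfying for all t ≥ 0 and all i = 1,…,N (writing y_i = C_i x_i, z_i^i for the i-th component of z_i, ω_i = −∇f_i(y_i)/z_i^i − γ₁ Σ_{j=1}^N a_{ij}(y_i − y_j) − γ₂ v_i, and u_i = −K_i x̂_i + Υ_i ω_i − (Φ_i − K_iΨ_i) ρ_i): ẋ_i = A_i x_i + B_i u_i, ẋ̂_i = A_i x̂_i + B_i u_i + H_i(y_i − C_i x̂_i), ρ̇_i = ω_i, v̇_i = γ₁ Σ_{j=1}^N a_{ij}(y_i − y_j), ż_i = −Σ_{j=1}^N a_{ij}(z_i − z_j). Then z_i^i(t) > 0 for all t ≥ 0, and y_i(t) converges exponentially to y*: there exist c, λ > 0 such that ∥y_i(t) − y*∥ ≤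 c e^{−λ t} for all t ≥ 0 and all i, where y* is the unique minimizer of Σ_{j=1}^N f_j over ℝ^q. -/

import Mathlib

open Matrix Finset

/-- Strong connectivity: every ordered pair of distinct nodes is joined by a
directed path along edges (`(j,i)` is an edge iff `a i j > 0`). -/
def StronglyConnected {N : ℕ} (a : Fin N → Fin N → ℝ) : Prop :=
  ∀ i j : Fin N, i ≠ j → Relation.TransGen (fun u v : Fin N => 0 < a v u) i j

/-- A real square matrix is Hurwitz if every complex eigenvalue (root of its
characteristic polynomial over `ℂ`) has negative real part. -/
def IsHurwitz {n : ℕ} (A : Matrix (Fin n) (Fin n) ℝ) : Prop :=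
  ∀ μ : ℂ, (Matrix.charpoly (A.map Complex.ofReal)).IsRoot μ → μ.re < 0

/-- The gradient of `f : ℝ^q → ℝ`, whose `s`-th component is the partial
derivative of `f` in the `s`-th coordinate direction. -/
noncomputable def grad {q : ℕ} (f : (Fin q → ℝ) → ℝ) (x : Fin q → ℝ) : Fin q → ℝ :=
  fun s => fderiv ℝ f x (Pi.single s 1)

/-- `f` is strongly convex with constant `m`:
`(x−y)ᵀ(∇f(x)−∇f(y)) ≥ m ∥x−y∥²` (Euclidean norm). -/
def StronglyConvexWith {q : ℕ} (m : ℝ) (f : (Fin q → ℝ) → ℝ) : Prop :=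
  ∀ x y : Fin q → ℝ,
    m * ∑ s, (x s - y s) ^ 2 ≤ ∑ s, (x s - y s) * (grad f x s - grad f y s)

/-- `grad f` is globally Lipschitz with constant `M` (stated in squared form,
equivalent to `∥∇f(x)−∇f(y)∥ ≤ M ∥x−y∥` for Euclidean norms). -/
def GradLipschitzWith {q : ℕ} (M : ℝ) (f : (Fin q → ℝ) → ℝ) : Prop :=
  ∀ x y : Fin q → ℝ,
    ∑ s, (grad f x s - grad f y s) ^ 2 ≤ M ^ 2 * ∑ s, (x s - y s) ^ 2

/-- A differentiable function on `[T, ∞)` with nonpositive derivative stays below its initial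
value. -/
theorem le_of_hasDerivAt_nonpos {g g' : ℝ → ℝ} {T t : ℝ} (hT : T ≤ t)
    (hg : ∀ s, T ≤ s → HasDerivAt g (g' s) s) (hg' : ∀ s, T ≤ s → g' s ≤ 0) : g t ≤ g T := by
  refine antitoneOn_of_deriv_nonpos (convex_Ici T)
    (fun s hs => (hg s hs).continuousAt.continuousWithinAt)
    (fun s hs => (hg s (interior_subset hs)).differentiableAt.differentiableWithinAt)
    (fun s hs => ?_) Set.self_mem_Ici hT hT
  rw [(hg s (interior_subset hs)).deriv]
  exact hg' s (interior_subset hs)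

theorem eq_of_hasDerivAt_zero {g : ℝ → ℝ} {T t : ℝ} (hT : T ≤ t)
    (hg : ∀ s, T ≤ s → HasDerivAt g 0 s) : g t = g T := by
  refine le_antisymm (le_of_hasDerivAt_nonpos hT hg fun _ _ => le_rfl) ?_
  have := le_of_hasDerivAt_nonpos (g := fun s => -g s) (g' := fun _ => -0) hT
    (fun s hs => (hg s hs).neg) fun _ _ => by simp
  simpa using this

/-- A nonnegative function whose growth is dominated by linear decay, up to an exponentially
small affine perturbation, decays exponentially. -/
theorem exists_exp_decay_of_hasDerivAt {U U' : ℝ → ℝ} {α μ c : ℝ} (hα : 0 < α) (hμ : 0 < μ)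
    (hc : 0 ≤ c) (hU0 : ∀ t, 0 ≤ t → 0 ≤ U t) (hU : ∀ t, 0 ≤ t → HasDerivAt U (U' t) t)
    (hle : ∀ t, 0 ≤ t → U' t ≤ -α * U t + c * Real.exp (-μ * t) * (1 + U t)) :
    ∃ C > 0, ∃ lam > 0, ∀ t, 0 ≤ t → U t ≤ C * Real.exp (-lam * t) := by
  have hlim : Filter.Tendsto (fun t => c * Real.exp (-μ * t)) Filter.atTop (nhds 0) := by
    have : Filter.Tendsto (fun t => -μ * t) Filter.atTop Filter.atBot :=
      Filter.tendsto_id.const_mul_atTop_of_neg (neg_neg_of_pos hμ)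
    simpa using (Real.tendsto_exp_atBot.comp this).const_mul c
  obtain ⟨S, hS⟩ := Filter.eventually_atTop.1
    ((hlim.eventually (ge_mem_nhds (half_pos hα))).and (Filter.eventually_ge_atTop 0))
  have hS0 : 0 ≤ S := (hS S le_rfl).2
  obtain ⟨β, hβ, hβα, hβμ⟩ : ∃ β > 0, β ≤ α / 2 ∧ β < μ :=
    ⟨min (α / 2) (μ / 2), by positivity, min_le_left _ _,
      (min_le_right _ _).trans_lt (half_lt_self hμ)⟩
  have hμβ : 0 < μ - β := sub_pos.2 hβμ
  let g : ℝ → ℝ := fun t => U t * Real.exp (β * t) + c / (μ - β) * Real.exp (-(μ - β) * t)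
  have hg : ∀ t, S ≤ t → g t ≤ g S := fun t ht =>
    le_of_hasDerivAt_nonpos ht
      (fun s hs => ((hU s (hS0.trans hs)).mul (((hasDerivAt_id s).const_mul β).exp)).add
        ((((hasDerivAt_id s).const_mul (-(μ - β))).exp).const_mul (c / (μ - β)))) fun s hs => by
      obtain ⟨h1, h3⟩ := hS s hs
      have hd := hle s h3
      have e1 : c / (μ - β) * (Real.exp (-(μ - β) * s) * (-(μ - β) * 1))
          = -(c * Real.exp (-μ * s)) * Real.exp (β * s) := by
        rw [show -(μ - β) * s = -μ * s + β * s by ring, Real.exp_add]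
        field_simp
      simp only [id]
      rw [e1]
      have hu := hU0 s h3
      have : U' s + β * U s - c * Real.exp (-μ * s) ≤ 0 := by
        nlinarith [mul_le_mul_of_nonneg_right h1 hu, mul_le_mul_of_nonneg_right hβα hu]
      nlinarith [mul_nonneg (neg_nonneg.2 this) (Real.exp_pos (β * s)).le]
  have hcont : ContinuousOn (fun t => U t * Real.exp (β * t)) (Set.Icc 0 S) := by
    refine ContinuousOn.mul (fun t ht => (hU t ht.1).continuousAt.continuousWithinAt) ?_
    fun_prop
  obtain ⟨b, hb⟩ := (isCompact_Icc.image_of_continuousOn hcont).bddAbove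
  have key : ∀ t, 0 ≤ t → U t * Real.exp (β * t) ≤ |b| + |g S| + 1 := by
    intro t ht
    rcases le_total t S with h | h
    · have := hb (Set.mem_image_of_mem _ (show t ∈ Set.Icc 0 S from ⟨ht, h⟩))
      linarith [le_abs_self b, abs_nonneg (g S)]
    · have h1 := hg t h
      have h2 : 0 ≤ c / (μ - β) * Real.exp (-(μ - β) * t) := by positivity
      have h3 : U t * Real.exp (β * t) ≤ g t := le_add_of_nonneg_right h2
      linarith [le_abs_self (g S), abs_nonneg b]
  refine ⟨|b| + |g S| + 1, by positivity, β, hβ, fun t ht => ?_⟩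
  rw [neg_mul, Real.exp_neg, ← div_eq_mul_inv, le_div_iff₀ (Real.exp_pos _)]
  exact key t ht

/-- Weights `r` for which the weighted digraph `a` becomes balanced (a left null vector of the
Laplacian). -/
def IsBalancing {N : ℕ} (a : Fin N → Fin N → ℝ) (r : Fin N → ℝ) : Prop :=
  ∀ j, ∑ i, r i * a i j = r j * ∑ k, a j k

/-- The weighted disagreement of `u` along the edges. -/
def edgeEnergy {N : ℕ} (a : Fin N → Fin N → ℝ) (r u : Fin N → ℝ) : ℝ :=
  ∑ i, ∑ j, r i * a i j * (u i - u j) ^ 2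

/-- Exponential decay on `[0, ∞)`. -/
def ExpDecay {E : Type*} [NormedAddCommGroup E] (g : ℝ → E) : Prop :=
  ∃ c > 0, ∃ lam > 0, ∀ t, 0 ≤ t → ‖g t‖ ≤ c * Real.exp (-lam * t)

section Hurwitz

variable {E F : Type*} [NormedAddCommGroup E] [NormedAddCommGroup F]

theorem ExpDecay.of_le {g : ℝ → E} {h : ℝ → F} (hg : ExpDecay g) (K : ℝ)
    (hle : ∀ t, 0 ≤ t → ‖h t‖ ≤ K * ‖g t‖) : ExpDecay h := by
  obtain ⟨c, hc, lam, hlam, hd⟩ := hg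
  refine ⟨(|K| + 1) * c, by positivity, lam, hlam, fun t ht => ?_⟩
  calc ‖h t‖ ≤ K * ‖g t‖ := hle t ht
    _ ≤ (|K| + 1) * ‖g t‖ :=
        mul_le_mul_of_nonneg_right (by linarith [le_abs_self K]) (norm_nonneg _)
    _ ≤ (|K| + 1) * (c * Real.exp (-lam * t)) :=
        mul_le_mul_of_nonneg_left (hd t ht) (by positivity)
    _ = _ := by ring

theorem ExpDecay.add {g h : ℝ → E} (hg : ExpDecay g) (hh : ExpDecay h) :
    ExpDecay fun t => g t + h t := by
  obtain ⟨c₁, hc₁, l₁, hl₁, h₁⟩ := hg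
  obtain ⟨c₂, hc₂, l₂, hl₂, h₂⟩ := hh
  refine ⟨c₁ + c₂, by positivity, min l₁ l₂, lt_min hl₁ hl₂, fun t ht => ?_⟩
  have e₁ : Real.exp (-l₁ * t) ≤ Real.exp (-(min l₁ l₂) * t) := by
    gcongr; exact min_le_left _ _
  have e₂ : Real.exp (-l₂ * t) ≤ Real.exp (-(min l₁ l₂) * t) := by
    gcongr; exact min_le_right _ _
  calc ‖g t + h t‖ ≤ ‖g t‖ + ‖h t‖ := norm_add_le _ _
    _ ≤ c₁ * Real.exp (-l₁ * t) + c₂ * Real.exp (-l₂ * t) := add_le_add (h₁ t ht) (h₂ t ht)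
    _ ≤ c₁ * Real.exp (-(min l₁ l₂) * t) + c₂ * Real.exp (-(min l₁ l₂) * t) := by gcongr
    _ = _ := by ring

theorem ExpDecay.mulVec {𝕜 : Type*} [RCLike 𝕜] {k l : ℕ} {g : ℝ → Fin l → 𝕜} (hg : ExpDecay g)
    (P : Matrix (Fin k) (Fin l) 𝕜) : ExpDecay fun t => P *ᵥ g t :=
  hg.of_le _ fun t _ => P.mulVecLin.toContinuousLinearMap.le_opNorm (g t)

theorem HasDerivAt.mulVec {𝕜 : Type*} [RCLike 𝕜] {k l : ℕ} {g : ℝ → Fin l → 𝕜}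
    {g' : Fin l → 𝕜} {t : ℝ} (hg : HasDerivAt g g' t) (P : Matrix (Fin k) (Fin l) 𝕜) :
    HasDerivAt (fun t => P *ᵥ g t) (P *ᵥ g') t :=
  ((P.mulVecLin.toContinuousLinearMap.restrictScalars ℝ).hasFDerivAt (x := g t)).comp_hasDerivAt
    t hg

/-- A stable scalar mode driven by an exponentially decaying input decays exponentially. -/
theorem ExpDecay.of_hasDerivAt_smul [NormedSpace ℂ E] {u g : ℝ → E} {μ : ℂ} (hμ : μ.re < 0)
    (hg : ExpDecay g) (hu : ∀ t, 0 ≤ t → HasDerivAt u (μ • u t + g t) t) : ExpDecay u := by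
  obtain ⟨c, hc, l, hl, hgl⟩ := hg
  set α := -μ.re with hα
  have hα0 : 0 < α := neg_pos.2 hμ
  obtain ⟨k, hk0, hkl, hkα⟩ : ∃ k > 0, k ≤ l ∧ k < α :=
    ⟨min l (α / 2), by positivity, min_le_left _ _, (min_le_right _ _).trans_lt (half_lt_self hα0)⟩
  have hαk : 0 < α - k := sub_pos.2 hkα
  have hexp : ∀ t : ℝ, HasDerivAt (fun t : ℝ => Complex.exp (-μ * t))
      (Complex.exp (-μ * t) * (-μ * 1)) t := fun t =>
    ((Complex.ofRealCLM.hasDerivAt (x := t)).const_mul (-μ)).cexp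
  have hnexp : ∀ t : ℝ, ‖Complex.exp (-μ * t)‖ = Real.exp (α * t) := by
    intro t
    rw [Complex.norm_exp]
    simp [hα]
  let h : ℝ → E := fun t => Complex.exp (-μ * t) • u t
  have hh : ∀ t : ℝ, 0 ≤ t → HasDerivAt h (Complex.exp (-μ * t) • g t) t := by
    intro t ht
    refine ((hexp t).smul (hu t ht)).congr_deriv ?_
    rw [smul_add, smul_smul, add_right_comm, ← add_smul]
    ring_nf
    simp
  let b : ℝ → ℝ := fun t => ‖u 0‖ + c / (α - k) * Real.exp ((α - k) * t)
  have hb : ∀ t, HasDerivAt b (c * Real.exp ((α - k) * t)) t := by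
    intro t
    refine ((((hasDerivAt_id t).const_mul (α - k)).exp.const_mul (c / (α - k))).const_add
      ‖u 0‖).congr_deriv ?_
    simp only [id]
    field_simp
  have hbound : ∀ t : ℝ, 0 ≤ t → ‖h t‖ ≤ b t := by
    intro t ht
    refine image_norm_le_of_norm_deriv_right_le_deriv_boundary (a := 0) (b := t)
      (fun s hs => (hh s hs.1).continuousAt.continuousWithinAt)
      (fun s hs => (hh s hs.1).hasDerivWithinAt) ?_ hb (fun s hs => ?_) ⟨ht, le_rfl⟩
    · simp only [h, b, Complex.ofReal_zero, mul_zero, Complex.exp_zero, one_smul]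
      have : 0 ≤ c / (α - k) * Real.exp 0 := by positivity
      linarith
    · rw [norm_smul, hnexp]
      calc Real.exp (α * s) * ‖g s‖ ≤ Real.exp (α * s) * (c * Real.exp (-l * s)) := by
            gcongr; exact hgl s hs.1
        _ ≤ Real.exp (α * s) * (c * Real.exp (-k * s)) := by
            have := hs.1
            gcongr
        _ = _ := by
            rw [show (α - k) * s = α * s + -k * s by ring, Real.exp_add]; ring
  refine ⟨‖u 0‖ + c / (α - k), by positivity, k, hk0, fun t ht => ?_⟩
  have h1 := hbound t ht
  simp only [h, b, norm_smul, hnexp] at h1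
  have e1 : ‖u t‖ = Real.exp (-α * t) * (Real.exp (α * t) * ‖u t‖) := by
    rw [← mul_assoc, ← Real.exp_add]; simp
  rw [e1]
  calc _ ≤ Real.exp (-α * t) * (‖u 0‖ + c / (α - k) * Real.exp ((α - k) * t)) := by gcongr
    _ = ‖u 0‖ * Real.exp (-α * t) + c / (α - k) * Real.exp (-k * t) := by
        rw [show -k * t = -α * t + (α - k) * t by ring, Real.exp_add]; ring
    _ ≤ ‖u 0‖ * Real.exp (-k * t) + c / (α - k) * Real.exp (-k * t) := by gcongr
    _ = _ := by ring

open Polynomial in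
theorem expDecay_of_aeval_prod {n : ℕ} (P : Matrix (Fin n) (Fin n) ℂ) (s : Multiset ℂ)
    (hs : ∀ μ ∈ s, μ.re < 0) {ξ d : ℝ → Fin n → ℂ} (hd : ExpDecay d)
    (hξ : ∀ t, 0 ≤ t → HasDerivAt ξ (P *ᵥ ξ t + d t) t)
    (h : ExpDecay fun t => aeval P (s.map fun μ => X - Polynomial.C μ).prod *ᵥ ξ t) :
    ExpDecay ξ := by
  induction s using Multiset.induction with
  | empty => simpa using h
  | cons μ s ih =>
    refine ih (fun ν hν => hs ν (Multiset.mem_cons_of_mem hν)) ?_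
    set Q := aeval P (s.map fun μ => X - Polynomial.C μ).prod with hQ
    have hcomm : Q * P = P * Q := by
      have : Commute (aeval P (s.map fun μ => X - Polynomial.C μ).prod) (aeval P X) :=
        (Commute.all _ _).map (aeval P)
      rw [aeval_X] at this
      exact this
    refine ExpDecay.of_hasDerivAt_smul (hs μ (Multiset.mem_cons_self _ _)) (h.add (hd.mulVec Q))
      fun t ht => ((hξ t ht).mulVec Q).congr_deriv ?_
    simp only [Multiset.map_cons, Multiset.prod_cons, map_mul, map_sub, aeval_X, aeval_C, ← hQ]
    rw [Matrix.sub_mul, Matrix.sub_mulVec, Matrix.mulVec_add, Matrix.mulVec_mulVec, hcomm,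
      Algebra.algebraMap_eq_smul_one, Matrix.smul_mul, Matrix.one_mul, Matrix.smul_mulVec]
    abel

theorem IsHurwitz.expDecay {n : ℕ} {P : Matrix (Fin n) (Fin n) ℝ} (hP : IsHurwitz P)
    {ξ d : ℝ → Fin n → ℝ} (hd : ExpDecay d)
    (hξ : ∀ t, 0 ≤ t → HasDerivAt ξ (P *ᵥ ξ t + d t) t) : ExpDecay ξ := by
  have hnorm : ∀ w : Fin n → ℝ, ‖fun i => (w i : ℂ)‖ = ‖w‖ := fun w => by
    simp [Pi.norm_def, nnnorm]
  set Pc := P.map Complex.ofReal with hPc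
  have key : ExpDecay fun t => fun i => (ξ t i : ℂ) := by
    refine expDecay_of_aeval_prod Pc Pc.charpoly.roots
      (fun μ hμ => hP μ (Polynomial.isRoot_of_mem_roots hμ))
      (d := fun t i => (d t i : ℂ)) (hd.of_le 1 fun t _ => by rw [hnorm, one_mul])
      (fun t ht => hasDerivAt_pi.2 fun i => ?_) ?_
    · refine ((hasDerivAt_pi.1 (hξ t ht) i).ofReal_comp).congr_deriv ?_
      simp [Matrix.mulVec, dotProduct, hPc]
    · rw [← (IsAlgClosed.splits Pc.charpoly).eq_prod_roots_of_monic (Matrix.charpoly_monic Pc),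
        Matrix.aeval_self_charpoly]
      exact ⟨1, one_pos, 1, one_pos, fun t _ => by simp; positivity⟩
  exact key.of_le 1 fun t _ => by rw [hnorm, one_mul]

theorem exists_pos_forall_le {ι : Type*} [Finite ι] {g : ι → ℝ} (hg : ∀ i, 0 < g i) :
    ∃ l > 0, ∀ i, l ≤ g i := by
  cases isEmpty_or_nonempty ι
  · exact ⟨1, one_pos, isEmptyElim⟩
  · obtain ⟨i, hi⟩ := Finite.exists_min g
    exact ⟨g i, hg i, hi⟩

theorem ExpDecay.pi {ι : Type*} [Fintype ι] {g : ℝ → ι → E}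
    (hg : ∀ i, ExpDecay fun t => g t i) : ExpDecay g := by
  choose c hc l hl h using hg
  obtain ⟨k, hk, hkl⟩ := exists_pos_forall_le hl
  have hc0 : 0 ≤ ∑ i, c i := sum_nonneg fun i _ => (hc i).le
  refine ⟨∑ i, c i + 1, by positivity, k, hk, fun t ht => ?_⟩
  refine (pi_norm_le_iff_of_nonneg (by positivity)).2 fun i => (h i t ht).trans ?_
  have h1 : c i ≤ ∑ i, c i + 1 :=
    (single_le_sum (fun i _ => (hc i).le) (mem_univ i)).trans (by linarith)
  have := hkl i
  have := (hc i).le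
  gcongr

theorem ExpDecay.of_sq_le {g : ℝ → E} {c lam : ℝ} (hc : 0 < c) (hlam : 0 < lam)
    (h : ∀ t, 0 ≤ t → ‖g t‖ ^ 2 ≤ c * Real.exp (-lam * t)) : ExpDecay g := by
  refine ⟨√c, Real.sqrt_pos.2 hc, lam / 2, half_pos hlam, fun t ht => ?_⟩
  refine (sq_le_sq₀ (norm_nonneg _) (by positivity)).1 ((h t ht).trans_eq ?_)
  rw [mul_pow, Real.sq_sqrt hc.le, ← Real.exp_nat_mul]
  ring_nf

theorem ExpDecay.one_div_sub {z : ℝ → ℝ} {r : ℝ} (hr : 0 < r) (hz : ∀ t, 0 ≤ t → 0 < z t)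
    (hcont : ∀ t, 0 ≤ t → ContinuousAt z t) (h : ExpDecay fun t => z t - r) :
    ExpDecay fun t => 1 / z t - 1 / r := by
  obtain ⟨δ, hδ, hδz⟩ : ∃ δ > 0, ∀ t, 0 ≤ t → δ ≤ z t := by
    obtain ⟨c, -, l, hl, hle⟩ := h
    have hlim : Filter.Tendsto (fun t => c * Real.exp (-l * t)) Filter.atTop (nhds 0) := by
      have : Filter.Tendsto (fun t => -l * t) Filter.atTop Filter.atBot :=
        Filter.tendsto_id.const_mul_atTop_of_neg (neg_neg_of_pos hl)
      simpa using (Real.tendsto_exp_atBot.comp this).const_mul c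
    obtain ⟨S, hS⟩ := Filter.eventually_atTop.1
      ((hlim.eventually (ge_mem_nhds (half_pos hr))).and (Filter.eventually_ge_atTop 0))
    obtain ⟨t₀, ht₀, hmin⟩ := isCompact_Icc.exists_isMinOn
      (Set.nonempty_Icc.2 (hS S le_rfl).2)
      fun t ht => (hcont t ht.1).continuousWithinAt
    refine ⟨min (z t₀) (r / 2), lt_min (hz _ ht₀.1) (half_pos hr), fun t ht => ?_⟩
    rcases le_total t S with h | h
    · exact (min_le_left _ _).trans (hmin ⟨ht, h⟩)
    · have h1 := (hle t ht).trans (hS t h).1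
      have h2 := neg_abs_le (z t - r)
      rw [Real.norm_eq_abs] at h1
      exact (min_le_right _ _).trans (by linarith)
  refine h.of_le (δ * r)⁻¹ fun t ht => ?_
  have hzt := hz t ht
  have e : 1 / z t - 1 / r = -((z t * r)⁻¹ * (z t - r)) := by
    field_simp
    ring
  rw [e, norm_neg, norm_mul, Real.norm_of_nonneg (by positivity)]
  have := hδz t ht
  gcongr

end Hurwitz

section Optimization

theorem fderiv_apply_eq_sum_grad {q : ℕ} (f : (Fin q → ℝ) → ℝ) (x y : Fin q → ℝ) :
    fderiv ℝ f x y = ∑ s, y s * grad f x s := by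
  conv_lhs => rw [pi_eq_sum_univ' y]
  simp [grad]

theorem StronglyConvexWith.add_sum_le {q : ℕ} {f : (Fin q → ℝ) → ℝ} {m : ℝ}
    (hconv : StronglyConvexWith m f) (hf : Differentiable ℝ f) (y : Fin q → ℝ) :
    f 0 + ∑ s, (y s * grad f 0 s + m / 2 * y s ^ 2) ≤ f y := by
  have hline : ∀ t : ℝ, HasDerivAt (fun t : ℝ => t • y) y t := fun t => by
    simpa using (hasDerivAt_id t).smul_const y
  have h := le_of_hasDerivAt_nonpos (T := 0) (t := 1) zero_le_one
    (g := fun t => t * ∑ s, y s * grad f 0 s + t ^ 2 * (m / 2 * ∑ s, y s ^ 2) - f (t • y))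
    (fun t _ => (((hasDerivAt_id t).mul_const _).add ((hasDerivAt_pow 2 t).mul_const _)).sub
      ((hf (t • y)).hasFDerivAt.comp_hasDerivAt t (hline t))) fun t ht => by
    rw [fderiv_apply_eq_sum_grad]
    rcases ht.eq_or_lt with rfl | ht
    · simp
    have hc := hconv (t • y) 0
    simp only [Pi.smul_apply, smul_eq_mul, Pi.zero_apply, sub_zero, mul_pow, mul_assoc,
      ← mul_sum] at hc
    simp only [mul_sub, sum_sub_distrib] at hc
    have : m * (t * ∑ s, y s ^ 2) ≤ ∑ s, y s * grad f (t • y) s - ∑ s, y s * grad f 0 s := by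
      refine le_of_mul_le_mul_left ?_ ht
      calc _ = m * (t ^ 2 * ∑ s, y s ^ 2) := by ring
        _ ≤ _ := by rw [mul_sub]; exact hc
    norm_num
    linarith
  simp only [sum_add_distrib, ← mul_sum]
  simp at h
  linarith

theorem exists_forall_sum_le_and_sum_grad_eq_zero {N q : ℕ} (hN : 0 < N)
    {f : Fin N → (Fin q → ℝ) → ℝ} {m : Fin N → ℝ} (hm : ∀ i, 0 < m i)
    (hf : ∀ i, Differentiable ℝ (f i)) (hconv : ∀ i, StronglyConvexWith (m i) (f i)) :
    ∃ y : Fin q → ℝ, (∀ x, ∑ j, f j y ≤ ∑ j, f j x) ∧ ∀ s, ∑ j, grad (f j) y s = 0 := by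
  have hdiff : Differentiable ℝ fun x => ∑ j, f j x := Differentiable.fun_sum fun j _ => hf j
  set b := ∑ j, m j with hbdef
  have hb : 0 < b := sum_pos (fun j _ => hm j) ⟨⟨0, hN⟩, mem_univ _⟩
  set c : Fin q → ℝ := fun s => ∑ j, grad (f j) 0 s with hc
  have hlow : ∀ y : Fin q → ℝ,
      ∑ j, f j 0 + b / 4 * ‖y‖ ^ 2 - ∑ s, c s ^ 2 / b ≤ ∑ j, f j y := by
    intro y
    have h1 := sum_le_sum fun j (_ : j ∈ univ) => (hconv j).add_sum_le (hf j) y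
    rw [sum_add_distrib, sum_comm] at h1
    have h2 : ∀ s, ∑ j, (y s * grad (f j) 0 s + m j / 2 * y s ^ 2)
        = y s * c s + b / 2 * y s ^ 2 := by
      intro s
      simp only [sum_add_distrib, hc, hbdef, mul_sum, sum_div, sum_mul]
    simp only [h2] at h1
    have h3 : ∀ s, b / 4 * y s ^ 2 - c s ^ 2 / b ≤ y s * c s + b / 2 * y s ^ 2 := by
      intro s
      have : y s * c s + b / 2 * y s ^ 2 - (b / 4 * y s ^ 2 - c s ^ 2 / b)
          = (b * y s / 2 + c s) ^ 2 / b := by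
        field_simp
        ring
      have h4 : 0 ≤ (b * y s / 2 + c s) ^ 2 / b := by positivity
      linarith
    have h5 := sum_le_sum fun s (_ : s ∈ univ) => h3 s
    rw [sum_sub_distrib, ← mul_sum] at h5
    have h6 : ‖y‖ ^ 2 ≤ ∑ s, y s ^ 2 := by
      refine (Real.le_sqrt (norm_nonneg _) (sum_nonneg fun s _ => sq_nonneg _)).1 ?_
      refine (pi_norm_le_iff_of_nonneg (Real.sqrt_nonneg _)).2 fun s => Real.le_sqrt_of_sq_le ?_
      rw [Real.norm_eq_abs, sq_abs]
      exact single_le_sum (f := fun s => y s ^ 2) (fun s _ => sq_nonneg _) (mem_univ s)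
    have h7 : b / 4 * ‖y‖ ^ 2 ≤ b / 4 * ∑ s, y s ^ 2 := by gcongr
    linarith
  obtain ⟨y, hy⟩ := hdiff.continuous.exists_forall_le' 0 (by
    have ht : Filter.Tendsto (fun y : Fin q → ℝ => b / 4 * ‖y‖ ^ 2)
        (Filter.cocompact _) Filter.atTop :=
      (((Filter.tendsto_pow_atTop two_ne_zero).comp tendsto_norm_cocompact_atTop)).const_mul_atTop
        (by positivity)
    filter_upwards [ht.eventually_ge_atTop (∑ s, c s ^ 2 / b)] with x hx
    have := hlow x
    linarith)
  refine ⟨y, hy, fun s => ?_⟩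
  have hmin : IsLocalMin (fun x => ∑ j, f j x) y := Filter.Eventually.of_forall hy
  have h0 := hmin.fderiv_eq_zero
  rw [fderiv_fun_sum fun j _ => hf j y] at h0
  simpa [grad] using DFunLike.congr_fun h0 (Pi.single s 1)

end Optimization

section Graph

variable {N : ℕ} {a : Fin N → Fin N → ℝ} {r : Fin N → ℝ}

theorem exists_isBalancing (hN : 0 < N) (ha : ∀ i j, 0 ≤ a i j) (hsc : StronglyConnected a) :
    ∃ r : Fin N → ℝ, (∀ i, 0 < r i) ∧ ∑ i, r i = 1 ∧ IsBalancing a r := by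
  have : Nonempty (Fin N) := ⟨⟨0, hN⟩⟩
  let Lap : Matrix (Fin N) (Fin N) ℝ := Matrix.diagonal (fun i => ∑ k, a i k) - Matrix.of a
  have hdet : Lap.det = 0 := by
    refine Matrix.exists_mulVec_eq_zero_iff.1 ⟨fun _ => 1, ?_, ?_⟩
    · intro h
      simpa using congrFun h ⟨0, hN⟩
    · ext i
      simp only [Lap, Matrix.sub_mulVec, Pi.sub_apply, Matrix.mulVec_diagonal]
      simp [Matrix.mulVec, dotProduct]
  obtain ⟨w, hw0, hw⟩ := Matrix.exists_vecMul_eq_zero_iff.2 hdet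
  have hwb : ∀ j, ∑ i, w i * a i j = w j * ∑ k, a j k := by
    intro j
    have := congrFun hw j
    simp only [Lap, Matrix.vecMul_sub, Matrix.vecMul_diagonal, Pi.sub_apply, Pi.zero_apply] at this
    simp only [Matrix.vecMul, dotProduct, Matrix.of_apply] at this
    linarith
  have hle : ∀ j, |w j| * ∑ k, a j k ≤ ∑ i, |w i| * a i j := by
    intro j
    calc |w j| * ∑ k, a j k = |∑ i, w i * a i j| := by
          rw [hwb, abs_mul, abs_of_nonneg (sum_nonneg fun k _ => ha j k)]
      _ ≤ ∑ i, |w i * a i j| := abs_sum_le_sum_abs _ _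
      _ = _ := by simp [abs_mul, abs_of_nonneg (ha _ _)]
  have habs : IsBalancing a fun i => |w i| := by
    intro j
    refine ((sum_eq_sum_iff_of_le fun j _ => hle j).1 ?_ j (mem_univ j)).symm
    rw [sum_comm]
    simp [mul_sum]
  have hpos : ∀ i, 0 < |w i| := by
    intro j
    by_contra hj
    have hj0 : |w j| = 0 := le_antisymm (not_lt.1 hj) (abs_nonneg _)
    have hstep : ∀ i k, 0 < a i k → |w k| = 0 → |w i| = 0 := by
      intro i k hik hk
      have h := habs k
      simp only [hk, zero_mul] at h
      have := (sum_eq_zero_iff_of_nonneg fun i _ => mul_nonneg (abs_nonneg (w i)) (ha i k)).1 h i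
        (mem_univ i)
      exact (mul_eq_zero.1 this).resolve_right hik.ne'
    apply hw0
    ext i
    by_cases hij : j = i
    · subst hij
      simpa using hj0
    · have : |w i| = 0 := by
        induction hsc j i hij with
        | single h => exact hstep _ _ h hj0
        | tail _ h ih =>
          rename_i b c hjb
          by_cases hb : j = b
          · subst hb
            exact hstep _ _ h hj0
          · exact hstep _ _ h (ih hb)
      simpa using this
  have hS : 0 < ∑ i, |w i| := sum_pos (fun i _ => hpos i) univ_nonempty
  refine ⟨fun i => |w i| / ∑ i, |w i|, fun i => div_pos (hpos i) hS, ?_, fun j => ?_⟩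
  · rw [← sum_div, div_self hS.ne']
  · have := habs j
    simp only [div_mul_eq_mul_div, ← sum_div]
    rw [this]

theorem edgeEnergy_nonneg (ha : ∀ i j, 0 ≤ a i j) (hr : ∀ i, 0 < r i) (u : Fin N → ℝ) :
    0 ≤ edgeEnergy a r u :=
  sum_nonneg fun i _ => sum_nonneg fun j _ =>
    mul_nonneg (mul_nonneg (hr i).le (ha i j)) (sq_nonneg _)

theorem exists_sq_sub_le_edgeEnergy (ha : ∀ i j, 0 ≤ a i j) (hsc : StronglyConnected a)
    (hr : ∀ i, 0 < r i) :
    ∃ κ > 0, ∀ (u : Fin N → ℝ) (i j : Fin N), (u i - u j) ^ 2 ≤ κ * edgeEnergy a r u := by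
  have hedge : ∀ i j, 0 < a j i → ∃ κ ≥ 0, ∀ u : Fin N → ℝ,
      (u i - u j) ^ 2 ≤ κ * edgeEnergy a r u := by
    intro i j hij
    have hw : 0 < r j * a j i := mul_pos (hr j) hij
    refine ⟨(r j * a j i)⁻¹, (inv_pos.2 hw).le, fun u => ?_⟩
    rw [le_inv_mul_iff₀ hw]
    calc r j * a j i * (u i - u j) ^ 2 = r j * a j i * (u j - u i) ^ 2 := by ring
      _ ≤ ∑ k, r j * a j k * (u j - u k) ^ 2 :=
        single_le_sum (f := fun k => r j * a j k * (u j - u k) ^ 2)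
          (fun k _ => mul_nonneg (mul_nonneg (hr j).le (ha j k)) (sq_nonneg _)) (mem_univ i)
      _ ≤ _ := single_le_sum (f := fun j => ∑ k, r j * a j k * (u j - u k) ^ 2)
          (fun j _ => sum_nonneg fun k _ =>
            mul_nonneg (mul_nonneg (hr j).le (ha j k)) (sq_nonneg _)) (mem_univ j)
  have hpair : ∀ i j, ∃ κ ≥ 0, ∀ u : Fin N → ℝ, (u i - u j) ^ 2 ≤ κ * edgeEnergy a r u := by
    intro i j
    by_cases hij : i = j
    · exact ⟨0, le_rfl, fun u => by simp [hij]⟩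
    induction hsc i j hij with
    | single h => exact hedge _ _ h
    | tail _ h ih =>
      rename_i b c hib
      obtain ⟨κ₁, h1, hκ₁⟩ := hedge _ _ h
      by_cases hb : i = b
      · subst hb
        exact ⟨κ₁, h1, hκ₁⟩
      · obtain ⟨κ₂, h2, hκ₂⟩ := ih hb
        refine ⟨2 * (κ₁ + κ₂), by positivity, fun u => ?_⟩
        have e1 := hκ₁ u
        have e2 := hκ₂ u
        nlinarith [sq_nonneg ((u i - u b) - (u b - u c))]
  choose κ h0 hκ using hpair
  refine ⟨∑ i, ∑ j, κ i j + 1, ?_, fun u i j => ?_⟩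
  · have : 0 ≤ ∑ i, ∑ j, κ i j := sum_nonneg fun i _ => sum_nonneg fun j _ => h0 i j
    linarith
  · refine (hκ i j u).trans (mul_le_mul_of_nonneg_right ?_ (edgeEnergy_nonneg ha hr u))
    have h1 : κ i j ≤ ∑ k, κ i k := single_le_sum (fun k _ => h0 i k) (mem_univ j)
    have h2 : ∑ k, κ i k ≤ ∑ i, ∑ k, κ i k :=
      single_le_sum (f := fun i => ∑ k, κ i k) (fun i _ => sum_nonneg fun k _ => h0 i k)
        (mem_univ i)
    linarith

/-- The balanced Laplacian telescopes every difference of a function of the nodes. -/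
theorem IsBalancing.sum_sub_eq_zero (hb : IsBalancing a r) (w : Fin N → ℝ) :
    ∑ i, r i * ∑ j, a i j * (w i - w j) = 0 := by
  have h1 : ∑ i, r i * ∑ j, a i j * (w i - w j)
      = ∑ i, (r i * ∑ j, a i j) * w i - ∑ i, ∑ j, r i * a i j * w j := by
    rw [← sum_sub_distrib]
    refine sum_congr rfl fun i _ => ?_
    rw [mul_sum, mul_sum, sum_mul, ← sum_sub_distrib]
    exact sum_congr rfl fun j _ => by ring
  rw [h1, sum_comm (f := fun i j => r i * a i j * w j)]
  simp only [← sum_mul]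
  rw [sub_eq_zero]
  exact sum_congr rfl fun i _ => by rw [hb i]

theorem IsBalancing.sum_mul_laplacian (hb : IsBalancing a r) (u : Fin N → ℝ) :
    ∑ i, r i * (u i * ∑ j, a i j * (u i - u j)) = edgeEnergy a r u / 2 := by
  have h := hb.sum_sub_eq_zero fun i => u i ^ 2
  have : edgeEnergy a r u = 2 * (∑ i, r i * (u i * ∑ j, a i j * (u i - u j)))
      - ∑ i, r i * ∑ j, a i j * (u i ^ 2 - u j ^ 2) := by
    rw [edgeEnergy, mul_sum, ← sum_sub_distrib]
    refine sum_congr rfl fun i _ => ?_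
    simp only [mul_sum]
    rw [← sum_sub_distrib]
    exact sum_congr rfl fun j _ => by ring
  linarith

/-- Along the Laplacian flow the weighted sum of a convex function of the states does not
increase. -/
theorem IsBalancing.sum_convex_le (hb : IsBalancing a r) (ha : ∀ i j, 0 ≤ a i j)
    (hr : ∀ i, 0 < r i) {ζ : ℝ → Fin N → ℝ}
    (hζ : ∀ t, 0 ≤ t → HasDerivAt ζ (fun i => -∑ j, a i j * (ζ t i - ζ t j)) t)
    {φ φ' : ℝ → ℝ} (hφ : ∀ x, HasDerivAt φ (φ' x) x)
    (hconv : ∀ x y, φ x - φ y ≤ φ' x * (x - y)) {t : ℝ} (ht : 0 ≤ t) :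
    ∑ i, r i * φ (ζ t i) ≤ ∑ i, r i * φ (ζ 0 i) := by
  refine le_of_hasDerivAt_nonpos (g := fun t => ∑ i, r i * φ (ζ t i)) ht
    (fun s hs => HasDerivAt.fun_sum fun i _ =>
      ((hφ (ζ s i)).comp s (hasDerivAt_pi.1 (hζ s hs) i)).const_mul (r i)) fun s _ => ?_
  rw [← hb.sum_sub_eq_zero fun i => -φ (ζ s i)]
  refine sum_le_sum fun i _ => mul_le_mul_of_nonneg_left ?_ (hr i).le
  rw [mul_neg, mul_sum, ← sum_neg_distrib]
  refine sum_le_sum fun j _ => ?_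
  nlinarith [mul_le_mul_of_nonneg_left (hconv (ζ s i) (ζ s j)) (ha i j)]

theorem IsBalancing.laplacian_flow_nonneg (hb : IsBalancing a r) (ha : ∀ i j, 0 ≤ a i j)
    (hr : ∀ i, 0 < r i) {ζ : ℝ → Fin N → ℝ}
    (hζ : ∀ t, 0 ≤ t → HasDerivAt ζ (fun i => -∑ j, a i j * (ζ t i - ζ t j)) t)
    (h0 : ∀ i, 0 ≤ ζ 0 i) {t : ℝ} (ht : 0 ≤ t) (i : Fin N) : 0 ≤ ζ t i := by
  have hφ : ∀ x : ℝ, HasDerivAt (fun x : ℝ => (min x 0) ^ 2) (2 * min x 0) x := by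
    intro x
    rcases lt_trichotomy x 0 with hx | rfl | hx
    · have h : HasDerivAt (fun x : ℝ => x ^ 2) (2 * x) x := by simpa using hasDerivAt_pow 2 x
      rw [min_eq_left hx.le]
      refine h.congr_of_eventuallyEq ?_
      filter_upwards [gt_mem_nhds hx] with y hy
      rw [min_eq_left hy.le]
    · have h : HasDerivAt (fun x : ℝ => x ^ 2) 0 0 := by simpa using hasDerivAt_pow 2 (0 : ℝ)
      rw [hasDerivAt_iff_isLittleO] at h ⊢
      simp only [min_self, mul_zero, smul_zero, sub_zero, ne_eq, OfNat.ofNat_ne_zero,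
        not_false_eq_true, zero_pow] at h ⊢
      refine (Asymptotics.IsBigO.of_norm_le fun y => ?_).trans_isLittleO h
      rw [Real.norm_eq_abs, abs_of_nonneg (sq_nonneg _)]
      rcases min_cases y 0 with ⟨h, _⟩ | ⟨h, _⟩ <;> rw [h]
      simpa using sq_nonneg y
    · rw [min_eq_right hx.le, mul_zero]
      refine (hasDerivAt_const x (0 : ℝ)).congr_of_eventuallyEq ?_
      filter_upwards [lt_mem_nhds hx] with y hy
      simp [min_eq_right hy.le]
  have hle := hb.sum_convex_le ha hr hζ hφ (fun x y => by
    rcases min_cases x 0 with ⟨hx, hx'⟩ | ⟨hx, hx'⟩ <;>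
    rcases min_cases y 0 with ⟨hy, hy'⟩ | ⟨hy, hy'⟩ <;> rw [hx, hy] <;>
    nlinarith [sq_nonneg (x - y), sq_nonneg y, sq_nonneg x]) ht
  simp only [min_eq_right (h0 _), ne_eq, OfNat.ofNat_ne_zero, not_false_eq_true, zero_pow,
    mul_zero, sum_const_zero] at hle
  have hi := (single_le_sum (f := fun i => r i * min (ζ t i) 0 ^ 2)
    (fun i _ => mul_nonneg (hr i).le (sq_nonneg _)) (mem_univ i)).trans hle
  have : min (ζ t i) 0 = 0 := by
    have := pow_eq_zero_iff (n := 2) (by norm_num) |>.1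
      (le_antisymm (nonpos_of_mul_nonpos_right hi (hr i)) (sq_nonneg _))
    exact this
  exact min_eq_right_iff.1 this

theorem IsBalancing.laplacian_flow_pos (hb : IsBalancing a r) (ha : ∀ i j, 0 ≤ a i j)
    (hr : ∀ i, 0 < r i) {ζ : ℝ → Fin N → ℝ}
    (hζ : ∀ t, 0 ≤ t → HasDerivAt ζ (fun i => -∑ j, a i j * (ζ t i - ζ t j)) t)
    (h0 : ∀ i, 0 ≤ ζ 0 i) {t : ℝ} (ht : 0 ≤ t) {i : Fin N} (hi : 0 < ζ 0 i) : 0 < ζ t i := by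
  have h := le_of_hasDerivAt_nonpos (g := fun s => -(ζ s i * Real.exp ((∑ j, a i j) * s))) ht
    (fun s hs => ((hasDerivAt_pi.1 (hζ s hs) i).mul
      (((hasDerivAt_id s).const_mul (∑ j, a i j)).exp)).neg) fun s hs => by
    have : 0 ≤ ∑ j, a i j * ζ s j :=
      sum_nonneg fun j _ => mul_nonneg (ha i j) (hb.laplacian_flow_nonneg ha hr hζ h0 hs j)
    have e : ∑ j, a i j * (ζ s i - ζ s j) = (∑ j, a i j) * ζ s i - ∑ j, a i j * ζ s j := by
      rw [sum_mul, ← sum_sub_distrib]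
      exact sum_congr rfl fun j _ => by ring
    rw [e]
    simp only [id]
    nlinarith [mul_nonneg this (Real.exp_pos ((∑ j, a i j) * s)).le]
  simp only [mul_zero, Real.exp_zero, mul_one, neg_le_neg_iff] at h
  exact pos_of_mul_pos_left (hi.trans_le h) (Real.exp_pos _).le

theorem IsBalancing.exists_laplacian_flow_sub_sq_le (hb : IsBalancing a r)
    (ha : ∀ i j, 0 ≤ a i j) (hsc : StronglyConnected a) (hr : ∀ i, 0 < r i) (hr1 : ∑ i, r i = 1)
    {ζ : ℝ → Fin N → ℝ}
    (hζ : ∀ t, 0 ≤ t → HasDerivAt ζ (fun i => -∑ j, a i j * (ζ t i - ζ t j)) t) (i : Fin N) :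
    ∃ c > 0, ∃ lam > 0, ∀ t, 0 ≤ t →
      (ζ t i - ∑ j, r j * ζ 0 j) ^ 2 ≤ c * Real.exp (-lam * t) := by
  obtain ⟨κ, hκ, hE⟩ := exists_sq_sub_le_edgeEnergy (r := r) ha hsc hr
  set b := ∑ j, r j * ζ 0 j with hbdef
  have hcons : ∀ t, 0 ≤ t → ∑ j, r j * ζ t j = b := fun t ht =>
    eq_of_hasDerivAt_zero (g := fun t => ∑ j, r j * ζ t j) ht fun s hs => by
      have := HasDerivAt.fun_sum (u := univ) fun i (_ : i ∈ univ) =>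
        (hasDerivAt_pi.1 (hζ s hs) i).const_mul (r i)
      simpa only [mul_neg, sum_neg_distrib, hb.sum_sub_eq_zero (ζ s), neg_zero] using this
  have hdist : ∀ t, 0 ≤ t → ∀ i, (ζ t i - b) ^ 2 ≤ κ * edgeEnergy a r (ζ t) := by
    intro t ht i
    have e : ζ t i - b = ∑ j, r j * (ζ t i - ζ t j) := by
      simp only [mul_sub, sum_sub_distrib, ← sum_mul, hr1, hcons t ht, one_mul]
    rw [e]
    refine (Real.pow_arith_mean_le_arith_mean_pow_of_even univ r _ (fun i _ => (hr i).le) hr1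
      even_two).trans ?_
    calc ∑ j, r j * (ζ t i - ζ t j) ^ 2 ≤ ∑ j, r j * (κ * edgeEnergy a r (ζ t)) :=
          sum_le_sum fun j _ => mul_le_mul_of_nonneg_left (hE _ i j) (hr j).le
      _ = _ := by rw [← sum_mul, hr1, one_mul]
  let W : ℝ → ℝ := fun t => ∑ i, r i * (ζ t i - b) ^ 2
  have hW0 : ∀ t, 0 ≤ W t := fun t => sum_nonneg fun i _ => mul_nonneg (hr i).le (sq_nonneg _)
  have hW : ∀ t, 0 ≤ t → HasDerivAt W (-edgeEnergy a r (ζ t)) t := by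
    intro t ht
    have h := HasDerivAt.fun_sum (u := univ) fun i (_ : i ∈ univ) =>
      (((hasDerivAt_pi.1 (hζ t ht) i).sub_const b).pow 2).const_mul (r i)
    refine h.congr_deriv ?_
    have hL := hb.sum_mul_laplacian fun i => ζ t i - b
    have e : edgeEnergy a r (fun i => ζ t i - b) = edgeEnergy a r (ζ t) := by
      simp [edgeEnergy]
    rw [e] at hL
    simp only [sub_sub_sub_cancel_right] at hL
    rw [show -edgeEnergy a r (ζ t) = -2 * (edgeEnergy a r (ζ t) / 2) by ring, ← hL, mul_sum]
    exact sum_congr rfl fun i _ => by push_cast; ring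
  obtain ⟨C, hC, lam, hlam, hdecay⟩ := exists_exp_decay_of_hasDerivAt (μ := 1) (c := 0)
    (inv_pos.2 hκ) one_pos le_rfl (fun t _ => hW0 t) hW fun t ht => by
      have : W t ≤ ∑ i, r i * (κ * edgeEnergy a r (ζ t)) :=
        sum_le_sum fun i _ => mul_le_mul_of_nonneg_left (hdist t ht i) (hr i).le
      rw [← sum_mul, hr1, one_mul] at this
      have h2 : κ⁻¹ * W t ≤ edgeEnergy a r (ζ t) := by rwa [inv_mul_le_iff₀ hκ]
      linarith
  refine ⟨C / r i, div_pos hC (hr i), lam, hlam, fun t ht => ?_⟩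
  rw [div_mul_eq_mul_div, le_div_iff₀ (hr i), mul_comm]
  exact (single_le_sum (f := fun i => r i * (ζ t i - b) ^ 2)
    (fun i _ => mul_nonneg (hr i).le (sq_nonneg _)) (mem_univ i)).trans (hdecay t ht)

/-- Dissipation inequality for the Lyapunov function
`∑ r_i (k |Y_i|² + |Y_i + V_i|²) / 2` of the error dynamics
`Y_i' = -G_i / r_i - γ ∑ a_ij (Y_i - Y_j) - V_i + D_i`, `V_i' = γ ∑ a_ij (Y_i - Y_j)`. -/
theorem IsBalancing.dissipation {q : ℕ} (hb : IsBalancing a r)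
    (ha : ∀ i j, 0 ≤ a i j) (hr : ∀ i, 0 < r i) (hr1 : ∑ i, r i = 1) (hN : 0 < N)
    {κ m₀ M₀ r₀ k γ : ℝ}
    (hκ : ∀ (u : Fin N → ℝ) (i j : Fin N), (u i - u j) ^ 2 ≤ κ * edgeEnergy a r u)
    (hr₀ : 0 < r₀) (hrr : ∀ i, r₀ ≤ r i) (hm₀ : 0 < m₀) (hk0 : 0 < k)
    (hk : M₀ ^ 2 / r₀ + 1 ≤ k * m₀) (hγ : (k + 1) ^ 2 * κ ≤ k * γ / 2)
    {Y V G D : Fin N → Fin q → ℝ}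
    (hG : ∀ i, m₀ * ∑ s, Y i s ^ 2 ≤ ∑ s, Y i s * G i s)
    (hG' : ∀ i, ∑ s, G i s ^ 2 ≤ M₀ ^ 2 * ∑ s, Y i s ^ 2)
    (hV : ∀ s, ∑ i, r i * V i s = 0) :
    ∑ i, ∑ s, r i * (k * (Y i s * (-G i s / r i - γ * ∑ j, a i j * (Y i s - Y j s)
        - V i s + D i s)) + (Y i s + V i s) * (-G i s / r i - V i s + D i s))
      ≤ -(1 / 2) * ∑ i, ∑ s, Y i s ^ 2 - 1 / 4 * ∑ i, ∑ s, r i * V i s ^ 2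
        + ((k + 1) ^ 2 / 2 + 1) * ∑ i, ∑ s, r i * D i s ^ 2 := by
  have hr_le : ∀ i, r i ≤ 1 := fun i =>
    (single_le_sum (fun i _ => (hr i).le) (mem_univ i)).trans_eq hr1
  have hterm : ∀ i s, r i * (k * (Y i s * (-G i s / r i - γ * ∑ j, a i j * (Y i s - Y j s)
        - V i s + D i s)) + (Y i s + V i s) * (-G i s / r i - V i s + D i s))
      ≤ (-(k + 1)) * (Y i s * G i s) + (1 / r₀) * G i s ^ 2 + (1 / 2) * Y i s ^ 2
        + (-(k * γ)) * (r i * (Y i s * ∑ j, a i j * (Y i s - Y j s)))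
        + (-(k + 1)) * (r i * (Y i s * V i s)) + (-(1 / 2)) * (r i * V i s ^ 2)
        + ((k + 1) ^ 2 / 2 + 1) * (r i * D i s ^ 2) := by
    intro i s
    have hri := hr i
    generalize ∑ j, a i j * (Y i s - Y j s) = ℓ
    have e1 : r i * (k * (Y i s * (-G i s / r i - γ * ℓ - V i s + D i s))
          + (Y i s + V i s) * (-G i s / r i - V i s + D i s))
        = -(k + 1) * (Y i s * G i s) - V i s * G i s - k * γ * (r i * (Y i s * ℓ))
          - (k + 1) * (r i * (Y i s * V i s)) - r i * V i s ^ 2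
          + r i * ((k + 1) * Y i s * D i s) + r i * (V i s * D i s) := by
      field_simp
      ring
    have h1 : -(V i s * G i s) ≤ r i * V i s ^ 2 / 4 + 1 / r₀ * G i s ^ 2 := by
      have e2 : r i * V i s ^ 2 / 4 + 1 / r i * G i s ^ 2 + V i s * G i s
          = (r i * V i s / 2 + G i s) ^ 2 / r i := by
        field_simp
        ring
      have e3 : 0 ≤ (r i * V i s / 2 + G i s) ^ 2 / r i := by positivity
      have e4 : 1 / r i * G i s ^ 2 ≤ 1 / r₀ * G i s ^ 2 := by
        gcongr
        exact hrr i
      linarith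
    have h2 : r i * ((k + 1) * Y i s * D i s)
        ≤ 1 / 2 * Y i s ^ 2 + (k + 1) ^ 2 / 2 * (r i * D i s ^ 2) := by
      nlinarith [mul_nonneg hri.le (sq_nonneg (Y i s - (k + 1) * D i s)),
        mul_nonneg (sub_nonneg.2 (hr_le i)) (sq_nonneg (Y i s))]
    have h3 : r i * (V i s * D i s) ≤ r i * V i s ^ 2 / 4 + r i * D i s ^ 2 := by
      nlinarith [mul_nonneg hri.le (sq_nonneg (V i s / 2 - D i s))]
    linarith
  have hcross : ∀ s, -(k * γ) * ∑ i, r i * (Y i s * ∑ j, a i j * (Y i s - Y j s))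
      + -(k + 1) * ∑ i, r i * (Y i s * V i s) ≤ 1 / 4 * ∑ i, r i * V i s ^ 2 := by
    intro s
    let o : Fin N := ⟨0, hN⟩
    rw [hb.sum_mul_laplacian fun i => Y i s]
    have hE0 := edgeEnergy_nonneg ha hr fun i => Y i s
    have h1 : ∑ i, r i * (Y i s * V i s) = ∑ i, r i * ((Y i s - Y o s) * V i s) := by
      have : ∑ i, r i * ((Y i s - Y o s) * V i s)
          = ∑ i, r i * (Y i s * V i s) - Y o s * ∑ i, r i * V i s := by
        rw [mul_sum, ← sum_sub_distrib]
        exact sum_congr rfl fun i _ => by ring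
      rw [this, hV s]
      ring
    have h2 : -(k + 1) * ∑ i, r i * ((Y i s - Y o s) * V i s)
        ≤ ∑ i, (1 / 4 * (r i * V i s ^ 2)
          + r i * ((k + 1) ^ 2 * (κ * edgeEnergy a r fun i => Y i s))) := by
      rw [mul_sum]
      refine sum_le_sum fun i _ => ?_
      have := mul_le_mul_of_nonneg_left (hκ (fun i => Y i s) i o) (sq_nonneg (k + 1))
      nlinarith [mul_nonneg (hr i).le (sq_nonneg (V i s / 2 + (k + 1) * (Y i s - Y o s))),
        mul_le_mul_of_nonneg_left this (hr i).le]
    rw [sum_add_distrib, ← mul_sum, ← sum_mul, hr1, ← h1] at h2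
    nlinarith [mul_le_mul_of_nonneg_right hγ hE0]
  have hsum := sum_le_sum fun i (_ : i ∈ univ) => sum_le_sum fun s (_ : s ∈ univ) => hterm i s
  simp only [sum_add_distrib, ← mul_sum] at hsum
  have hcr := sum_le_sum fun s (_ : s ∈ univ) => hcross s
  simp only [sum_add_distrib, ← mul_sum] at hcr
  rw [sum_comm (f := fun s i => r i * (Y i s * ∑ j, a i j * (Y i s - Y j s))),
    sum_comm (f := fun s i => r i * (Y i s * V i s)),
    sum_comm (f := fun s i => r i * V i s ^ 2)] at hcr
  have hg1 := sum_le_sum fun i (_ : i ∈ univ) => hG i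
  have hg2 := sum_le_sum fun i (_ : i ∈ univ) => hG' i
  simp only [sum_add_distrib, ← mul_sum] at hg1 hg2 hsum hcr ⊢
  have hY0 : 0 ≤ ∑ i, ∑ s, Y i s ^ 2 := sum_nonneg fun i _ => sum_nonneg fun s _ => sq_nonneg _
  generalize ∑ i, ∑ s, Y i s ^ 2 = SY at *
  have hg3 := mul_le_mul_of_nonneg_left hg2 (one_div_pos.2 hr₀).le
  have hg4 := mul_le_mul_of_nonneg_left hg1 (by positivity : 0 ≤ k + 1)
  have hk2 := mul_le_mul_of_nonneg_right hk hY0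
  have e : 1 / r₀ * (M₀ ^ 2 * SY) = M₀ ^ 2 / r₀ * SY := by ring
  have := mul_nonneg hm₀.le hY0
  rw [e] at hg3
  linarith

theorem IsBalancing.laplacian_flow_diag (hb : IsBalancing a r) (ha : ∀ i j, 0 ≤ a i j)
    (hsc : StronglyConnected a) (hr : ∀ i, 0 < r i) (hr1 : ∑ i, r i = 1)
    {z : Fin N → ℝ → Fin N → ℝ} (hz0 : ∀ i, z i 0 = Pi.single i 1)
    (hz : ∀ i t, 0 ≤ t → HasDerivAt (z i) (fun k => -∑ j, a i j * (z i t k - z j t k)) t)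
    (i : Fin N) :
    (∀ t, 0 ≤ t → 0 < z i t i) ∧ ExpDecay fun t => 1 / z i t i - 1 / r i := by
  have hζ : ∀ t, 0 ≤ t → HasDerivAt (fun t j => z j t i)
      (fun j => -∑ k, a j k * (z j t i - z k t i)) t := fun t ht =>
    hasDerivAt_pi.2 fun j => hasDerivAt_pi.1 (hz j t ht) i
  have hpos : ∀ t, 0 ≤ t → 0 < z i t i := fun t ht =>
    hb.laplacian_flow_pos ha hr hζ (fun j => by
      rw [hz0, Pi.single_apply]
      split_ifs <;> norm_num) ht (by simp [hz0])
  obtain ⟨c, hc, lam, hlam, h⟩ := hb.exists_laplacian_flow_sub_sq_le ha hsc hr hr1 hζ i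
  refine ⟨hpos, ExpDecay.one_div_sub (hr i) hpos
    (fun t ht => (hasDerivAt_pi.1 (hz i t ht) i).continuousAt)
    (ExpDecay.of_sq_le hc hlam fun t ht => ?_)⟩
  have e : ∑ j, r j * z j 0 i = r i := by simp [hz0, Pi.single_apply]
  have := h t ht
  rwa [e, ← sq_abs, ← Real.norm_eq_abs] at this

/-- Exponential convergence of the primal-dual output dynamics under exponentially decaying
additive and gradient-scaling perturbations. -/
theorem IsBalancing.perturbed_convergence {q : ℕ} (hb : IsBalancing a r)
    (ha : ∀ i j, 0 ≤ a i j) (hr : ∀ i, 0 < r i) (hr1 : ∑ i, r i = 1) (hN : 0 < N)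
    {κ m₀ M₀ r₀ k γ : ℝ}
    (hκ : ∀ (u : Fin N → ℝ) (i j : Fin N), (u i - u j) ^ 2 ≤ κ * edgeEnergy a r u)
    (hr₀ : 0 < r₀) (hrr : ∀ i, r₀ ≤ r i) (hm₀ : 0 < m₀) (hk0 : 0 < k)
    (hk : M₀ ^ 2 / r₀ + 1 ≤ k * m₀) (hγ : (k + 1) ^ 2 * κ ≤ k * γ / 2)
    {f : Fin N → (Fin q → ℝ) → ℝ} (hconv : ∀ i, StronglyConvexWith m₀ (f i))
    (hlip : ∀ i, GradLipschitzWith M₀ (f i))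
    {p : Fin q → ℝ} (hp : ∀ s, ∑ i, grad (f i) p s = 0)
    {y v d : Fin N → ℝ → Fin q → ℝ} {θ : Fin N → ℝ → ℝ}
    (hd : ∀ i, ExpDecay (d i)) (hθ : ∀ i, ExpDecay (θ i)) (hv0 : ∀ i, v i 0 = 0)
    (hy : ∀ i t, 0 ≤ t → HasDerivAt (y i) (fun s =>
      -(grad (f i) (y i t) s) * (1 / r i + θ i t) - γ * ∑ j, a i j * (y i t s - y j t s)
        - v i t s + d i t s) t)
    (hv : ∀ i t, 0 ≤ t → HasDerivAt (v i) (fun s =>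
      γ * ∑ j, a i j * (y i t s - y j t s)) t) :
    ∃ c > 0, ∃ lam > 0, ∀ i t, 0 ≤ t →
      √(∑ s, (y i t s - p s) ^ 2) ≤ c * Real.exp (-lam * t) := by
  let Y : ℝ → Fin N → Fin q → ℝ := fun t i s => y i t s - p s
  let V : ℝ → Fin N → Fin q → ℝ := fun t i s => v i t s + grad (f i) p s / r i
  let G : ℝ → Fin N → Fin q → ℝ := fun t i s => grad (f i) (y i t) s - grad (f i) p s
  let D : ℝ → Fin N → Fin q → ℝ := fun t i s => d i t s - θ i t * grad (f i) (y i t) s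
  have hYd : ∀ t, 0 ≤ t → ∀ i s, HasDerivAt (fun t => Y t i s)
      (-G t i s / r i - γ * ∑ j, a i j * (Y t i s - Y t j s) - V t i s + D t i s) t := by
    intro t ht i s
    refine ((hasDerivAt_pi.1 (hy i t ht) s).sub_const (p s)).congr_deriv ?_
    simp only [Y, V, G, D, sub_sub_sub_cancel_right]
    ring
  have hVd : ∀ t, 0 ≤ t → ∀ i s, HasDerivAt (fun t => V t i s)
      (γ * ∑ j, a i j * (Y t i s - Y t j s)) t := by
    intro t ht i s
    refine ((hasDerivAt_pi.1 (hv i t ht) s).add_const _).congr_deriv ?_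
    simp only [Y, sub_sub_sub_cancel_right]
  have hV : ∀ t, 0 ≤ t → ∀ s, ∑ i, r i * V t i s = 0 := by
    intro t ht s
    refine (eq_of_hasDerivAt_zero (g := fun t => ∑ i, r i * V t i s) ht fun τ hτ => ?_).trans ?_
    · refine (HasDerivAt.fun_sum fun i (_ : i ∈ univ) =>
        (hVd τ hτ i s).const_mul (r i)).congr_deriv ?_
      simp only [mul_left_comm _ γ, ← mul_sum]
      rw [hb.sum_sub_eq_zero fun i => Y τ i s, mul_zero]
    · have : ∀ i, r i * V 0 i s = grad (f i) p s := fun i => by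
        simp only [V, hv0, Pi.zero_apply, zero_add]
        exact mul_div_cancel₀ _ (hr i).ne'
      simp only [this, hp s]
  have hG : ∀ t i, m₀ * ∑ s, Y t i s ^ 2 ≤ ∑ s, Y t i s * G t i s := fun t i =>
    hconv i (y i t) p
  have hG' : ∀ t i, ∑ s, G t i s ^ 2 ≤ M₀ ^ 2 * ∑ s, Y t i s ^ 2 := fun t i =>
    hlip i (y i t) p
  let U : ℝ → ℝ := fun t => ∑ i, ∑ s, r i * (k * Y t i s ^ 2 + (Y t i s + V t i s) ^ 2) / 2
  have hU : ∀ t, 0 ≤ t → HasDerivAt U (∑ i, ∑ s, r i * (k * (Y t i s * (-G t i s / r i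
      - γ * ∑ j, a i j * (Y t i s - Y t j s) - V t i s + D t i s))
      + (Y t i s + V t i s) * (-G t i s / r i - V t i s + D t i s))) t := by
    intro t ht
    refine HasDerivAt.fun_sum fun i _ => HasDerivAt.fun_sum fun s _ => ?_
    refine ((((((hYd t ht i s).pow 2).const_mul k).add
      (((hYd t ht i s).add (hVd t ht i s)).pow 2)).const_mul (r i)).div_const 2).congr_deriv ?_
    simp only [Pi.add_apply]
    push_cast
    ring
  have hr_le : ∀ i, r i ≤ 1 := fun i =>
    (single_le_sum (fun i _ => (hr i).le) (mem_univ i)).trans_eq hr1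
  have hU0 : ∀ t, 0 ≤ U t := fun t => sum_nonneg fun i _ => sum_nonneg fun s _ => by
    have := hr i
    positivity
  have hYU : ∀ t, k * r₀ / 2 * ∑ i, ∑ s, Y t i s ^ 2 ≤ U t := by
    intro t
    simp only [mul_sum]
    refine sum_le_sum fun i _ => sum_le_sum fun s _ => ?_
    nlinarith [mul_nonneg (hr i).le (sq_nonneg (Y t i s + V t i s)),
      mul_nonneg (mul_nonneg hk0.le (sub_nonneg.2 (hrr i))) (sq_nonneg (Y t i s))]
  have hUle : ∀ t, U t ≤ (k / 2 + 1) * ∑ i, ∑ s, Y t i s ^ 2 + ∑ i, ∑ s, r i * V t i s ^ 2 := by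
    intro t
    simp only [mul_sum, ← sum_add_distrib, U]
    refine sum_le_sum fun i _ => sum_le_sum fun s _ => ?_
    nlinarith [mul_nonneg (hr i).le (sq_nonneg (Y t i s - V t i s)),
      mul_nonneg (mul_nonneg hk0.le (sub_nonneg.2 (hr_le i))) (sq_nonneg (Y t i s)),
      mul_nonneg (sub_nonneg.2 (hr_le i)) (sq_nonneg (Y t i s))]
  obtain ⟨c₁, hc₁, μ, hμ, hη⟩ := ((ExpDecay.pi (g := fun t i => d i t) hd).of_le (h := fun t =>
      ‖fun i => d i t‖) 1 fun t _ => by simp).add ((ExpDecay.pi (g := fun t i => θ i t) hθ).of_le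
        (h := fun t => ‖fun i => θ i t‖) 1 fun t _ => by simp)
  set η : ℝ → ℝ := fun t => ‖fun i => d i t‖ + ‖fun i => θ i t‖ with hηdef
  set Γ := ∑ i, ∑ s, grad (f i) p s ^ 2 with hΓ
  have hΓ0 : 0 ≤ Γ := sum_nonneg fun i _ => sum_nonneg fun s _ => sq_nonneg _
  have hD : ∀ t, ∑ i, ∑ s, r i * D t i s ^ 2
      ≤ η t ^ 2 * (2 * (N * q) + 4 * M₀ ^ 2 * ∑ i, ∑ s, Y t i s ^ 2 + 4 * Γ) := by
    intro t
    have h1 : ∀ i s, r i * D t i s ^ 2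
        ≤ η t ^ 2 * (2 + 4 * G t i s ^ 2 + 4 * grad (f i) p s ^ 2) := by
      intro i s
      have hd1 : d i t s ^ 2 ≤ η t ^ 2 := by
        have h := (norm_le_pi_norm (d i t) s).trans (norm_le_pi_norm (fun i => d i t) i)
        rw [← sq_abs, ← Real.norm_eq_abs]
        exact pow_le_pow_left₀ (norm_nonneg _) (h.trans (le_add_of_nonneg_right (norm_nonneg _))) 2
      have hθ1 : θ i t ^ 2 ≤ η t ^ 2 := by
        have h := norm_le_pi_norm (fun i => θ i t) i
        rw [← sq_abs, ← Real.norm_eq_abs]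
        exact pow_le_pow_left₀ (norm_nonneg _) (h.trans (le_add_of_nonneg_left (norm_nonneg _))) 2
      have hg : grad (f i) (y i t) s ^ 2 ≤ 2 * G t i s ^ 2 + 2 * grad (f i) p s ^ 2 := by
        nlinarith [sq_nonneg (G t i s - grad (f i) p s),
          show grad (f i) (y i t) s = G t i s + grad (f i) p s by simp [G]]
      have hD1 : D t i s ^ 2 ≤ 2 * d i t s ^ 2 + 2 * (θ i t ^ 2 * grad (f i) (y i t) s ^ 2) := by
        nlinarith [sq_nonneg (d i t s + θ i t * grad (f i) (y i t) s)]
      have h2 : r i * D t i s ^ 2 ≤ D t i s ^ 2 := mul_le_of_le_one_left (sq_nonneg _) (hr_le i)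
      have h3 : θ i t ^ 2 * grad (f i) (y i t) s ^ 2
          ≤ η t ^ 2 * (2 * G t i s ^ 2 + 2 * grad (f i) p s ^ 2) := by gcongr
      linarith
    refine (sum_le_sum fun i _ => sum_le_sum fun s _ => h1 i s).trans ?_
    simp only [← mul_sum, sum_add_distrib, sum_const, card_univ, Fintype.card_fin, nsmul_eq_mul]
    refine mul_le_mul_of_nonneg_left ?_ (sq_nonneg _)
    have := sum_le_sum fun i (_ : i ∈ univ) => hG' t i
    rw [← mul_sum] at this
    linarith
  set L := (k + 1) ^ 2 / 2 + 1 with hL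
  set b := 2 * (N * q) + 4 * Γ + 4 * M₀ ^ 2 * (2 / (k * r₀)) with hbdef
  have hdiss : ∀ t, 0 ≤ t → ∑ i, ∑ s, r i * (k * (Y t i s * (-G t i s / r i
      - γ * ∑ j, a i j * (Y t i s - Y t j s) - V t i s + D t i s))
      + (Y t i s + V t i s) * (-G t i s / r i - V t i s + D t i s))
      ≤ -(1 / (2 * k + 4)) * U t + L * c₁ ^ 2 * b * Real.exp (-(2 * μ) * t) * (1 + U t) := by
    intro t ht
    refine (hb.dissipation ha hr hr1 hN hκ hr₀ hrr hm₀ hk0 hk hγ (hG t) (hG' t) (hV t ht)).trans ?_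
    have hη2 : η t ^ 2 ≤ c₁ ^ 2 * Real.exp (-(2 * μ) * t) := by
      have h1 := hη t ht
      have h0 : 0 ≤ η t := by positivity
      rw [Real.norm_of_nonneg h0] at h1
      calc η t ^ 2 ≤ (c₁ * Real.exp (-μ * t)) ^ 2 := by gcongr
        _ = _ := by
          rw [mul_pow, ← Real.exp_nat_mul]
          ring_nf
    have hYU' : ∑ i, ∑ s, Y t i s ^ 2 ≤ 2 / (k * r₀) * U t := by
      rw [div_mul_eq_mul_div, le_div_iff₀ (by positivity)]
      linarith [hYU t]
    have hDt := hD t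
    have hUt := hUle t
    have hU0t := hU0 t
    have hY0 : 0 ≤ ∑ i, ∑ s, Y t i s ^ 2 :=
      sum_nonneg fun i _ => sum_nonneg fun s _ => sq_nonneg _
    have hV0 : 0 ≤ ∑ i, ∑ s, r i * V t i s ^ 2 :=
      sum_nonneg fun i _ => sum_nonneg fun s _ => mul_nonneg (hr i).le (sq_nonneg _)
    generalize ∑ i, ∑ s, Y t i s ^ 2 = SY at *
    generalize ∑ i, ∑ s, r i * V t i s ^ 2 = SV at *
    generalize ∑ i, ∑ s, r i * D t i s ^ 2 = SD at *
    generalize U t = u at *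
    have h1 : 1 / (2 * k + 4) * u ≤ 1 / 2 * SY + 1 / 4 * SV := by
      rw [div_mul_eq_mul_div, one_mul, div_le_iff₀ (by positivity)]
      nlinarith [mul_nonneg hk0.le hY0, mul_nonneg hk0.le hV0]
    have h2 : 2 * ((N : ℝ) * q) + 4 * M₀ ^ 2 * SY + 4 * Γ ≤ b * (1 + u) := by
      have e1 : 4 * M₀ ^ 2 * SY ≤ 4 * M₀ ^ 2 * (2 / (k * r₀) * u) := by gcongr
      have e2 : 0 ≤ 4 * M₀ ^ 2 * (2 / (k * r₀)) := by positivity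
      have e3 : 0 ≤ (2 * ((N : ℝ) * q) + 4 * Γ) * u := by positivity
      rw [hbdef]
      linarith
    have h3 : SD ≤ c₁ ^ 2 * Real.exp (-(2 * μ) * t) * (b * (1 + u)) :=
      hDt.trans (mul_le_mul hη2 h2 (by positivity) (by positivity))
    have h4 : L * SD ≤ L * (c₁ ^ 2 * Real.exp (-(2 * μ) * t) * (b * (1 + u))) := by
      gcongr
    rw [← hL]
    linarith
  obtain ⟨C, hC, lam, hlam, hdecay⟩ := exists_exp_decay_of_hasDerivAt (by positivity)
    (by positivity) (by positivity) (fun t _ => hU0 t) hU hdiss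
  refine ⟨√(2 / (k * r₀) * C), by positivity, lam / 2, half_pos hlam, fun i t ht => ?_⟩
  refine Real.sqrt_le_iff.2 ⟨by positivity, ?_⟩
  rw [mul_pow, Real.sq_sqrt (by positivity), ← Real.exp_nat_mul]
  have h1 : ∑ s, (y i t s - p s) ^ 2 ≤ ∑ i, ∑ s, Y t i s ^ 2 :=
    single_le_sum (f := fun i => ∑ s, Y t i s ^ 2)
      (fun i _ => sum_nonneg fun s _ => sq_nonneg _) (mem_univ i)
  have h2 : ∑ i, ∑ s, Y t i s ^ 2 ≤ 2 / (k * r₀) * U t := by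
    rw [div_mul_eq_mul_div, le_div_iff₀ (by positivity)]
    linarith [hYU t]
  calc _ ≤ 2 / (k * r₀) * U t := h1.trans h2
    _ ≤ 2 / (k * r₀) * (C * Real.exp (-lam * t)) := by
      gcongr
      exact hdecay t ht
    _ = _ := by
      push_cast
      ring_nf

theorem StronglyConvexWith.mono {q : ℕ} {f : (Fin q → ℝ) → ℝ} {m m' : ℝ}
    (h : StronglyConvexWith m f) (hm : m' ≤ m) : StronglyConvexWith m' f := fun x y =>
  (mul_le_mul_of_nonneg_right hm (sum_nonneg fun _ _ => sq_nonneg _)).trans (h x y)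

theorem GradLipschitzWith.mono {q : ℕ} {f : (Fin q → ℝ) → ℝ} {M M' : ℝ}
    (h : GradLipschitzWith M f) (hM : 0 ≤ M) (hM' : M ≤ M') : GradLipschitzWith M' f := fun x y =>
  (h x y).trans (mul_le_mul_of_nonneg_right (pow_le_pow_left₀ hM hM' 2)
    (sum_nonneg fun _ _ => sq_nonneg _))

theorem exists_gains_of_isBalancing {q : ℕ} (hN : 0 < N) (hb : IsBalancing a r)
    (ha : ∀ i j, 0 ≤ a i j) (hsc : StronglyConnected a) (hr : ∀ i, 0 < r i) (hr1 : ∑ i, r i = 1)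
    {f : Fin N → (Fin q → ℝ) → ℝ} {m M : Fin N → ℝ} (hm : ∀ i, 0 < m i) (hM : ∀ i, 0 < M i)
    (hconv : ∀ i, StronglyConvexWith (m i) (f i)) (hlip : ∀ i, GradLipschitzWith (M i) (f i)) :
    ∃ γ > 0, ∀ p : Fin q → ℝ, (∀ s, ∑ i, grad (f i) p s = 0) →
      ∀ (y v d : Fin N → ℝ → Fin q → ℝ) (θ : Fin N → ℝ → ℝ),
      (∀ i, ExpDecay (d i)) → (∀ i, ExpDecay (θ i)) → (∀ i, v i 0 = 0) →
      (∀ i t, 0 ≤ t → HasDerivAt (y i) (fun s =>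
        -(grad (f i) (y i t) s) * (1 / r i + θ i t) - γ * ∑ j, a i j * (y i t s - y j t s)
          - v i t s + d i t s) t) →
      (∀ i t, 0 ≤ t → HasDerivAt (v i) (fun s => γ * ∑ j, a i j * (y i t s - y j t s)) t) →
      ∃ c > 0, ∃ lam > 0, ∀ i t, 0 ≤ t →
        √(∑ s, (y i t s - p s) ^ 2) ≤ c * Real.exp (-lam * t) := by
  obtain ⟨κ, hκ0, hκ⟩ := exists_sq_sub_le_edgeEnergy (r := r) ha hsc hr
  obtain ⟨m₀, hm₀, hmm⟩ := exists_pos_forall_le hm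
  obtain ⟨r₀, hr₀, hrr⟩ := exists_pos_forall_le hr
  set M₀ := ∑ i, M i
  have hMM : ∀ i, M i ≤ M₀ := fun i => single_le_sum (fun i _ => (hM i).le) (mem_univ i)
  set k := (M₀ ^ 2 / r₀ + 1) / m₀ with hk
  have hk0 : 0 < k := by positivity
  refine ⟨2 * ((k + 1) ^ 2 * κ) / k, by positivity, fun p hp y v d θ hd hθ hv0 hy hv => ?_⟩
  refine hb.perturbed_convergence ha hr hr1 hN hκ hr₀ hrr hm₀ hk0 ?_ ?_
    (fun i => (hconv i).mono (hmm i)) (fun i => (hlip i).mono (hM i).le (hMM i)) hp hd hθ hv0 hy hv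
  · rw [hk, div_mul_cancel₀ _ hm₀.ne']
  · rw [mul_div_cancel₀ _ hk0.ne', mul_div_cancel_left₀ _ two_ne_zero]

end Graph

/-- Under observer-based feedback with internal reference `ρ`, the output satisfies the
integrator dynamics of `ρ` up to an exponentially decaying term. -/
theorem exists_expDecay_output {n p q : ℕ} {A : Matrix (Fin n) (Fin n) ℝ}
    {B : Matrix (Fin n) (Fin p) ℝ} {C : Matrix (Fin q) (Fin n) ℝ} {K : Matrix (Fin p) (Fin n) ℝ}
    {H : Matrix (Fin n) (Fin q) ℝ} {Ψ : Matrix (Fin n) (Fin q) ℝ} {Φ Υ : Matrix (Fin p) (Fin q) ℝ}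
    (hΨ : C * Ψ = 1) (hΦ : B * Φ = A * Ψ) (hΥ : B * Υ = Ψ) (hK : IsHurwitz (A - B * K))
    (hH : IsHurwitz (A - H * C)) {x xhat : ℝ → Fin n → ℝ} {ρ ω : ℝ → Fin q → ℝ}
    (hx : ∀ t, 0 ≤ t → HasDerivAt x (A *ᵥ x t + B *ᵥ (-(K *ᵥ xhat t) + Υ *ᵥ ω t
      - (Φ - K * Ψ) *ᵥ ρ t)) t)
    (hxhat : ∀ t, 0 ≤ t → HasDerivAt xhat (A *ᵥ xhat t + B *ᵥ (-(K *ᵥ xhat t) + Υ *ᵥ ω t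
      - (Φ - K * Ψ) *ᵥ ρ t) + H *ᵥ (C *ᵥ x t - C *ᵥ xhat t)) t)
    (hρ : ∀ t, 0 ≤ t → HasDerivAt ρ (ω t) t) :
    ∃ d : ℝ → Fin q → ℝ, ExpDecay d ∧
      ∀ t, 0 ≤ t → HasDerivAt (fun t => C *ᵥ x t) (ω t + d t) t := by
  have hzero : ExpDecay fun _ : ℝ => (0 : Fin n → ℝ) :=
    ⟨1, one_pos, 1, one_pos, fun t _ => by simp; positivity⟩
  have he : ExpDecay fun t => x t - xhat t :=
    hH.expDecay hzero fun t ht => ((hx t ht).sub (hxhat t ht)).congr_deriv (by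
      simp only [Matrix.sub_mulVec, Matrix.mulVec_sub, ← Matrix.mulVec_mulVec]
      abel)
  have hxx : ∀ t, A *ᵥ x t + B *ᵥ (-(K *ᵥ xhat t) + Υ *ᵥ ω t - (Φ - K * Ψ) *ᵥ ρ t)
      = (A - B * K) *ᵥ (x t - Ψ *ᵥ ρ t) + (B * K) *ᵥ (x t - xhat t) + Ψ *ᵥ ω t := by
    intro t
    have h1 : B *ᵥ (Φ *ᵥ ρ t) = A *ᵥ (Ψ *ᵥ ρ t) := by simp only [Matrix.mulVec_mulVec, hΦ]
    have h2 : B *ᵥ (Υ *ᵥ ω t) = Ψ *ᵥ ω t := by simp only [Matrix.mulVec_mulVec, hΥ]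
    simp only [Matrix.sub_mulVec, Matrix.mulVec_sub, Matrix.mulVec_add, Matrix.mulVec_neg,
      ← Matrix.mulVec_mulVec, h1, h2]
    abel
  have hξ : ExpDecay fun t => x t - Ψ *ᵥ ρ t :=
    hK.expDecay (he.mulVec (B * K)) fun t ht =>
      ((hx t ht).sub ((hρ t ht).mulVec Ψ)).congr_deriv (by rw [hxx]; abel)
  refine ⟨_, ((hξ.mulVec (A - B * K)).add (he.mulVec (B * K))).mulVec C, fun t ht =>
    ((hx t ht).mulVec C).congr_deriv ?_⟩
  rw [hxx, Matrix.mulVec_add, Matrix.mulVec_mulVec (ω t), hΨ, Matrix.one_mulVec, add_comm]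

/-- Theorem 2 of the paper: optimal output consensus via the distributed
observer-based output feedback controller (16). -/
theorem optimal_output_consensus_output_feedback
    (N q : ℕ) (hN : 2 ≤ N) (a : Fin N → Fin N → ℝ)
    (ha_nonneg : ∀ i j, 0 ≤ a i j) (ha_diag : ∀ i, a i i = 0)
    (hsc : StronglyConnected a)
    (n p : Fin N → ℕ)
    (A : (i : Fin N) → Matrix (Fin (n i)) (Fin (n i)) ℝ)
    (B : (i : Fin N) → Matrix (Fin (n i)) (Fin (p i)) ℝ)
    (C : (i : Fin N) → Matrix (Fin q) (Fin (n i)) ℝ)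
    (K : (i : Fin N) → Matrix (Fin (p i)) (Fin (n i)) ℝ)
    (H : (i : Fin N) → Matrix (Fin (n i)) (Fin q) ℝ)
    (Ψ : (i : Fin N) → Matrix (Fin (n i)) (Fin q) ℝ)
    (Φ Υ : (i : Fin N) → Matrix (Fin (p i)) (Fin q) ℝ)
    (hΨ : ∀ i, C i * Ψ i = 1)
    (hΦ : ∀ i, B i * Φ i = A i * Ψ i)
    (hΥ : ∀ i, B i * Υ i = Ψ i)
    (hK : ∀ i, IsHurwitz (A i - B i * K i))
    (hH : ∀ i, IsHurwitz (A i - H i * C i))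
    (f : Fin N → (Fin q → ℝ) → ℝ) (m M : Fin N → ℝ)
    (hm : ∀ i, 0 < m i) (hM : ∀ i, 0 < M i)
    (hC1 : ∀ i, ContDiff ℝ 1 (f i))
    (hconv : ∀ i, StronglyConvexWith (m i) (f i))
    (hlip : ∀ i, GradLipschitzWith (M i) (f i)) :
    ∃ γ₁ > (0 : ℝ), ∃ γ₂ > (0 : ℝ),
      ∀ (x xhat : (i : Fin N) → ℝ → Fin (n i) → ℝ)
        (ρ v : Fin N → ℝ → Fin q → ℝ)
        (z : Fin N → ℝ → Fin N → ℝ),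
        -- initial conditions: v_i(0) = 0, z_i(0) = e_i
        (∀ i, v i 0 = 0) →
        (∀ i, z i 0 = Pi.single i 1) →
        -- closed-loop dynamics, writing `y_i = C_i x_i`,
        -- `ω_i = −∇f_i(y_i)/z_i^i − γ₁ Σ_j a_{ij}(y_i − y_j) − γ₂ v_i`
        -- and `u_i = −K_i x̂_i + Υ_i ω_i − (Φ_i − K_iΨ_i) ρ_i`
        (∀ i : Fin N, ∀ t : ℝ, 0 ≤ t →
          (HasDerivAt (x i)
            ((A i).mulVec (x i t) +
              (B i).mulVec
                (-(K i).mulVec (xhat i t) +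
                  (Υ i).mulVec (fun s =>
                    -(grad (f i) ((C i).mulVec (x i t)) s) / z i t i -
                      γ₁ * ∑ j, a i j * (((C i).mulVec (x i t)) s -
                        ((C j).mulVec (x j t)) s) -
                      γ₂ * v i t s) -
                  (Φ i - K i * Ψ i).mulVec (ρ i t))) t) ∧
          (HasDerivAt (xhat i)
            ((A i).mulVec (xhat i t) +
              (B i).mulVec
                (-(K i).mulVec (xhat i t) +
                  (Υ i).mulVec (fun s =>
                    -(grad (f i) ((C i).mulVec (x i t)) s) / z i t i -
                      γ₁ * ∑ j, a i j * (((C i).mulVec (x i t)) s -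
                        ((C j).mulVec (x j t)) s) -
                      γ₂ * v i t s) -
                  (Φ i - K i * Ψ i).mulVec (ρ i t)) +
              (H i).mulVec ((C i).mulVec (x i t) - (C i).mulVec (xhat i t))) t) ∧
          (HasDerivAt (ρ i)
            (fun s =>
              -(grad (f i) ((C i).mulVec (x i t)) s) / z i t i -
                γ₁ * ∑ j, a i j * (((C i).mulVec (x i t)) s -
                  ((C j).mulVec (x j t)) s) -
                γ₂ * v i t s) t) ∧
          (HasDerivAt (v i)
            (fun s =>
              γ₁ * ∑ j, a i j * (((C i).mulVec (x i t)) s -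
                ((C j).mulVec (x j t)) s)) t) ∧
          (HasDerivAt (z i)
            (fun k => -∑ j, a i j * (z i t k - z j t k)) t)) →
        -- conclusion: well-posedness of the controller and exponential
        -- convergence of every output to the unique global minimizer
        (∀ i : Fin N, ∀ t : ℝ, 0 ≤ t → 0 < z i t i) ∧
        ∃ ystar : Fin q → ℝ,
          (∀ y : Fin q → ℝ, ∑ j, f j ystar ≤ ∑ j, f j y) ∧
          ∃ c > (0 : ℝ), ∃ lam > (0 : ℝ),
            ∀ i : Fin N, ∀ t : ℝ, 0 ≤ t →
              Real.sqrt (∑ s, (((C i).mulVec (x i t)) s - ystar s) ^ 2) ≤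
                c * Real.exp (-lam * t) := by
  have hN0 : 0 < N := by omega
  obtain ⟨r, hr, hr1, hb⟩ := exists_isBalancing hN0 ha_nonneg hsc
  obtain ⟨γ, hγ, hgain⟩ := exists_gains_of_isBalancing hN0 hb ha_nonneg hsc hr hr1 hm hM hconv hlip
  obtain ⟨ystar, hmin, hgrad⟩ := exists_forall_sum_le_and_sum_grad_eq_zero hN0 hm
    (fun i => (hC1 i).differentiable one_ne_zero) hconv
  refine ⟨γ, hγ, 1, one_pos, ?_⟩
  intro x xhat ρ v z hv0 hz0 hdyn
  have hz := fun i t ht => (hdyn i t ht).2.2.2.2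
  have hv := fun i t ht => (hdyn i t ht).2.2.2.1
  let ω : (i : Fin N) → ℝ → Fin q → ℝ := fun i t s =>
    -(grad (f i) (C i *ᵥ x i t) s) / z i t i
      - γ * ∑ j, a i j * ((C i *ᵥ x i t) s - (C j *ᵥ x j t) s) - 1 * v i t s
  have hout : ∀ i, ∃ d : ℝ → Fin q → ℝ, ExpDecay d ∧
      ∀ t, 0 ≤ t → HasDerivAt (fun t => C i *ᵥ x i t) (ω i t + d t) t := fun i =>
    exists_expDecay_output (ω := ω i) (ρ := ρ i) (xhat := xhat i) (hΨ i) (hΦ i) (hΥ i) (hK i)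
      (hH i) (fun t ht => (hdyn i t ht).1) (fun t ht => (hdyn i t ht).2.1)
      (fun t ht => (hdyn i t ht).2.2.1)
  clear hdyn
  choose d hd hy using hout
  have hdiag := hb.laplacian_flow_diag ha_nonneg hsc hr hr1 hz0 hz
  refine ⟨fun i => (hdiag i).1, ystar, hmin, ?_⟩
  refine hgain ystar hgrad (fun i t => C i *ᵥ x i t) v d (fun i t => 1 / z i t i - 1 / r i) hd
    (fun i => (hdiag i).2) hv0 (fun i t ht => (hy i t ht).congr_deriv ?_) hv
  ext s
  simp only [Pi.add_apply, ω]
  ring
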